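/- Suppose R(u) = c for all u ∈ I, where c ≠ 0, and suppose 1 − (c/2)φ'(u) ≠ 0 and 1 − (c/2) sin φ(u)/f(u) ≠ 0 for all u ∈ I. Then the parallel surface x* := x + (c/2)N satisfies, at every (u,v) ∈ I × ℝ, ‖∂x*/∂u‖²/(−⟨∂x*/∂u, ∂N/∂u⟩) + ‖∂x*/∂v‖²/(−⟨∂x*/∂v, ∂N/∂v⟩) = 0; that is, the sum of the principal radii of curvature of x* vanishes identically, so x* is a minimal surface and the original surface is a parallel surface of a minimal surface. -/

import Mathlib

open Real

/-- The surface of revolution `x(u,v) = (f(u) cos v, f(u) sin v, g(u))`. -/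
noncomputable def xMap (f g : ℝ → ℝ) (u v : ℝ) : ℝ × ℝ × ℝ :=
  (f u * Real.cos v, f u * Real.sin v, g u)

/-- The Gauss map `N(u,v) = (−sin φ(u) cos v, −sin φ(u) sin v, cos φ(u))`. -/
noncomputable def nMap (φ : ℝ → ℝ) (u v : ℝ) : ℝ × ℝ × ℝ :=
  (-(Real.sin (φ u)) * Real.cos v, -(Real.sin (φ u)) * Real.sin v, Real.cos (φ u))

/-- The sum of the principal radii of curvature `R = f/sin φ + 1/φ'`. -/
noncomputable def Rsum (φ f : ℝ → ℝ) (u : ℝ) : ℝ :=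
  f u / Real.sin (φ u) + 1 / deriv φ u

/-- The Euclidean inner product on `ℝ³`. -/
def dot3 (p q : ℝ × ℝ × ℝ) : ℝ := p.1 * q.1 + p.2.1 * q.2.1 + p.2.2 * q.2.2

/-- The parallel surface `x* = x + μN`. -/
noncomputable def pStar (φ f g : ℝ → ℝ) (μ : ℝ) (u v : ℝ) : ℝ × ℝ × ℝ :=
  xMap f g u v + μ • nMap φ u v

theorem hasDerivAt_nMap_left {φ : ℝ → ℝ} {u φ' : ℝ} (hφ : HasDerivAt φ φ' u) (v : ℝ) :
    HasDerivAt (fun t => nMap φ t v)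
      (-φ' • (cos (φ u) * cos v, cos (φ u) * sin v, sin (φ u))) u := by
  have h := (hφ.sin.neg.mul_const (cos v)).prodMk
    ((hφ.sin.neg.mul_const (sin v)).prodMk hφ.cos)
  refine h.congr_deriv ?_
  ext <;> simp <;> ring

theorem hasDerivAt_nMap_right (φ : ℝ → ℝ) (u v : ℝ) :
    HasDerivAt (fun t => nMap φ u t) (-sin (φ u) • (-sin v, cos v, 0)) v := by
  have h := ((hasDerivAt_cos v).const_mul (-sin (φ u))).prodMk
    (((hasDerivAt_sin v).const_mul (-sin (φ u))).prodMk (hasDerivAt_const v (cos (φ u))))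
  refine h.congr_deriv ?_
  ext <;> simp

theorem hasDerivAt_pStar_left {φ f g : ℝ → ℝ} {u φ' : ℝ} (hφ : HasDerivAt φ φ' u)
    (hf : HasDerivAt f (cos (φ u)) u) (hg : HasDerivAt g (sin (φ u)) u) (μ v : ℝ) :
    HasDerivAt (fun t => pStar φ f g μ t v)
      ((1 - μ * φ') • (cos (φ u) * cos v, cos (φ u) * sin v, sin (φ u))) u := by
  have h := ((hf.mul_const (cos v)).prodMk ((hf.mul_const (sin v)).prodMk hg)).add
    ((hasDerivAt_nMap_left hφ v).const_smul μ)
  refine h.congr_deriv ?_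
  ext <;> simp <;> ring

theorem hasDerivAt_pStar_right (φ f g : ℝ → ℝ) (μ u v : ℝ) :
    HasDerivAt (fun t => pStar φ f g μ u t)
      ((f u - μ * sin (φ u)) • (-sin v, cos v, 0)) v := by
  have h := (((hasDerivAt_cos v).const_mul (f u)).prodMk
    (((hasDerivAt_sin v).const_mul (f u)).prodMk (hasDerivAt_const v (g u)))).add
    ((hasDerivAt_nMap_right φ u v).const_smul μ)
  refine h.congr_deriv ?_
  ext <;> simp <;> ring

theorem dot3_smul_smul (r s : ℝ) (p q : ℝ × ℝ × ℝ) :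
    dot3 (r • p) (s • q) = r * s * dot3 p q := by
  simp only [dot3, Prod.smul_fst, Prod.smul_snd, smul_eq_mul]
  ring

theorem dot3_meridian (α v : ℝ) :
    dot3 (cos α * cos v, cos α * sin v, sin α) (cos α * cos v, cos α * sin v, sin α) = 1 := by
  simp only [dot3]
  linear_combination cos α ^ 2 * sin_sq_add_cos_sq v + sin_sq_add_cos_sq α

theorem dot3_parallel (v : ℝ) : dot3 (-sin v, cos v, 0) (-sin v, cos v, 0) = 1 := by
  simp only [dot3]
  linear_combination sin_sq_add_cos_sq v

/-- Theorem 2, converse direction: if R ≡ c ≠ 0, then the parallel surface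
x* = x + (c/2)N has vanishing sum of principal radii of curvature, i.e. it is minimal. -/
theorem parallel_at_half_R_is_minimal
    (a b : ℝ) (φ f g : ℝ → ℝ)
    (hφ : ContDiff ℝ (⊤ : ℕ∞) φ) (hf : ContDiff ℝ (⊤ : ℕ∞) f) (hg : ContDiff ℝ (⊤ : ℕ∞) g)
    (hfd : ∀ u ∈ Set.Ioo a b, deriv f u = Real.cos (φ u))
    (hgd : ∀ u ∈ Set.Ioo a b, deriv g u = Real.sin (φ u))
    (hfpos : ∀ u ∈ Set.Ioo a b, 0 < f u)
    (hsin : ∀ u ∈ Set.Ioo a b, Real.sin (φ u) ≠ 0)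
    (hφd : ∀ u ∈ Set.Ioo a b, deriv φ u ≠ 0)
    (c : ℝ) (hc : c ≠ 0)
    (hR : ∀ u ∈ Set.Ioo a b, Rsum φ f u = c)
    (hμ1 : ∀ u ∈ Set.Ioo a b, 1 - c / 2 * deriv φ u ≠ 0)
    (hμ2 : ∀ u ∈ Set.Ioo a b, 1 - c / 2 * (Real.sin (φ u) / f u) ≠ 0) :
    ∀ u ∈ Set.Ioo a b, ∀ v : ℝ,
      dot3 (deriv (fun t => pStar φ f g (c / 2) t v) u)
            (deriv (fun t => pStar φ f g (c / 2) t v) u)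
          / (-dot3 (deriv (fun t => pStar φ f g (c / 2) t v) u)
              (deriv (fun t => nMap φ t v) u))
        + dot3 (deriv (fun t => pStar φ f g (c / 2) u t) v)
              (deriv (fun t => pStar φ f g (c / 2) u t) v)
          / (-dot3 (deriv (fun t => pStar φ f g (c / 2) u t) v)
              (deriv (fun t => nMap φ u t) v))
        = 0 := by
  intro u hu v
  have dφ : HasDerivAt φ (deriv φ u) u := (hφ.differentiable (by simp) u).hasDerivAt
  have df : HasDerivAt f (cos (φ u)) u := hfd u hu ▸ (hf.differentiable (by simp) u).hasDerivAt
  have dg : HasDerivAt g (sin (φ u)) u := hgd u hu ▸ (hg.differentiable (by simp) u).hasDerivAt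
  rw [(hasDerivAt_pStar_left dφ df dg (c / 2) v).deriv, (hasDerivAt_nMap_left dφ v).deriv,
    (hasDerivAt_pStar_right φ f g (c / 2) u v).deriv, (hasDerivAt_nMap_right φ u v).deriv]
  simp only [dot3_smul_smul, dot3_meridian, dot3_parallel, mul_one, mul_neg, neg_neg]
  have h1 := hμ1 u hu
  have h2 : f u - c / 2 * sin (φ u) ≠ 0 := by
    have hfu := (hfpos u hu).ne'
    have h : f u - c / 2 * sin (φ u) = f u * (1 - c / 2 * (sin (φ u) / f u)) := by
      field_simp
    rw [h]
    exact mul_ne_zero hfu (hμ2 u hu)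
  have hs := hsin u hu
  have hd := hφd u hu
  have hRu := hR u hu
  rw [Rsum] at hRu
  rw [mul_div_mul_left _ _ h1, mul_div_mul_left _ _ h2, sub_div, sub_div,
    mul_div_cancel_right₀ _ hd, mul_div_cancel_right₀ _ hs]
  linarith
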